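/- Let g be a simple Lie algebra with sl2-triple {f,2x,e}, f minimal nilpotent, and let s ∈ g_{1/2} be embeddable with [s,s*]=2x. Then f + zs is ad-semisimple in g((z⁻¹)), and g((z⁻¹)) decomposes as h ⊕ h⊥ where h = F(f+zs)((z⁻¹)) ⊕ g₀^s((z⁻¹)) ⊕ F(e+z⁻¹s*)((z⁻¹)) = Ker ad(f+zs), and h⊥ = Im ad(f+zs) contains (2f - zs), x, (2e - z⁻¹s*), [f,g_{1/2}^s], [s,[f,g_{1/2}^s]], and [s,[s,[f,g_{1/2}^s]]] (over F((z⁻¹))). In particular [f+zs, e+z⁻¹s*] = 0 and [f+zs, 2x] = 2f - zs. -/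

import Mathlib

open scoped TensorProduct

attribute [-instance] HahnSeries.instModule

set_option maxHeartbeats 1000000

section EmbeddableTriple

variable {F g : Type*} [Field F] [LieRing g] [LieAlgebra F g]

/-- An `sl₂`-triple `{f, 2x, e}` whose `ad x`-grading has depth one, with one-dimensional extremal
components, together with `s ∈ g_{1/2}` and `sstar ∈ g_{-1/2}` satisfying `⁅s, sstar⁆ = 2x`. -/
structure IsEmbeddable (F : Type*) {g : Type*} [Field F] [LieRing g] [LieAlgebra F g]
    (e x f s sstar : g) : Prop where
  lie_e_f : ⁅e, f⁆ = (2 : F) • x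
  lie_x_e : ⁅x, e⁆ = (1 : F) • e
  lie_x_f : ⁅x, f⁆ = (-1 : F) • f
  grading : ∀ y : g, ∃ (c₁ c₂ : F) (u a v : g),
      ⁅x, u⁆ = (-(1 / 2 : F)) • u ∧ ⁅x, a⁆ = 0 ∧ ⁅x, v⁆ = (1 / 2 : F) • v ∧
      y = c₁ • f + u + a + v + c₂ • e
  lie_x_s : ⁅x, s⁆ = (1 / 2 : F) • s
  lie_x_sstar : ⁅x, sstar⁆ = (-(1 / 2 : F)) • sstar
  lie_s_sstar : ⁅s, sstar⁆ = (2 : F) • x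

theorem lie_weight_add {x a b : g} {w w' : F} (w'' : F) (ha : ⁅x, a⁆ = w • a)
    (hb : ⁅x, b⁆ = w' • b) (hw : w + w' = w'') : ⁅x, ⁅a, b⁆⁆ = w'' • ⁅a, b⁆ := by
  rw [leibniz_lie, ha, hb, smul_lie, lie_smul, ← hw, add_smul]

namespace IsEmbeddable

variable {e x f s sstar : g}

theorem lie_f_e (h : IsEmbeddable F e x f s sstar) : ⁅f, e⁆ = (-2 : F) • x := by
  rw [← lie_skew, h.lie_e_f, neg_smul]

/-- The raising operator `ad s` and the lowering operator `ad sstar` form an `sl₂`-pair. -/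
theorem lie_sstar_lie_s (h : IsEmbeddable F e x f s sstar) (y : g) :
    ⁅sstar, ⁅s, y⁆⁆ = (-2 : F) • ⁅x, y⁆ + ⁅s, ⁅sstar, y⁆⁆ := by
  rw [leibniz_lie, ← lie_skew sstar s, h.lie_s_sstar, neg_lie, smul_lie, neg_smul]

section Weights

variable [CharZero F]

theorem exists_smul_of_weight (h : IsEmbeddable F e x f s sstar) {y : g} {w : F}
    (hy : ⁅x, y⁆ = w • y) :
    ∃ c c' : F, ((w + 1) * (w + 1 / 2) * w * (w - 1 / 2)) • y = c • e ∧
      ((w - 1) * (w + 1 / 2) * w * (w - 1 / 2)) • y = c' • f := by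
  obtain ⟨c₁, c₂, u, a, v, hu, ha, hv, hdec⟩ := h.grading y
  refine ⟨c₂ * (3 / 2), c₁ * (3 / 2), ?_⟩
  have step (n : F) (p q r k : F)
      (hn : n • y = p • f + q • u + r • v + k • e) :
      (w * n) • y = -p • f + (-(1 / 2) * q) • u + (1 / 2 * r) • v + k • e := by
    have := congrArg (⁅x, ·⁆) hn
    simp only [lie_add, lie_smul, hy, h.lie_x_f, hu, hv, h.lie_x_e, smul_smul] at this
    linear_combination (norm := module) this
  have h1 : w • y = (-c₁) • f + (-(1 / 2) : F) • u + (1 / 2 : F) • v + c₂ • e := by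
    rw [← hy]
    conv_lhs => rw [hdec]
    simp only [lie_add, lie_smul, h.lie_x_f, hu, hv, ha, h.lie_x_e, smul_smul]
    module
  have h2 := step _ _ _ _ _ h1
  have h3 := step _ _ _ _ _ h2
  have h4 := step _ _ _ _ _ h3
  constructor
  · linear_combination (norm := module) h4 + h3 - (1 / 4 : F) • h2 - (1 / 4 : F) • h1
  · linear_combination (norm := module) h4 - h3 - (1 / 4 : F) • h2 + (1 / 4 : F) • h1

theorem exists_eq_smul_e (h : IsEmbeddable F e x f s sstar) {y : g}
    (hy : ⁅x, y⁆ = (1 : F) • y) : ∃ c : F, y = c • e := by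
  obtain ⟨c, -, hc, -⟩ := h.exists_smul_of_weight hy
  refine ⟨(2 / 3) * c, ?_⟩
  linear_combination (norm := module) (2 / 3 : F) • hc

theorem exists_eq_smul_f (h : IsEmbeddable F e x f s sstar) {y : g}
    (hy : ⁅x, y⁆ = (-1 : F) • y) : ∃ c : F, y = c • f := by
  obtain ⟨-, c, -, hc⟩ := h.exists_smul_of_weight hy
  refine ⟨(2 / 3) * c, ?_⟩
  linear_combination (norm := module) (2 / 3 : F) • hc

theorem eq_zero_of_weight (h : IsEmbeddable F e x f s sstar) {y : g} {w : F}
    (hy : ⁅x, y⁆ = w • y) (hw : (w + 1) * (w + 1 / 2) * w * (w - 1 / 2) * (w - 1) ≠ 0) :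
    y = 0 := by
  obtain ⟨c, -, hc, -⟩ := h.exists_smul_of_weight hy
  have := congrArg (⁅x, ·⁆) hc
  simp only [lie_smul, hy, h.lie_x_e] at this
  refine (smul_eq_zero.mp ?_).resolve_left hw
  linear_combination (norm := module) this - hc

theorem lie_e_of_weight_half (h : IsEmbeddable F e x f s sstar) {u : g}
    (hu : ⁅x, u⁆ = (1 / 2 : F) • u) : ⁅e, u⁆ = 0 :=
  h.eq_zero_of_weight (lie_weight_add (3 / 2) h.lie_x_e hu (by norm_num)) (by norm_num)

theorem lie_f_of_weight_neg_half (h : IsEmbeddable F e x f s sstar) {u : g}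
    (hu : ⁅x, u⁆ = (-(1 / 2) : F) • u) : ⁅f, u⁆ = 0 :=
  h.eq_zero_of_weight (lie_weight_add (-(3 / 2)) h.lie_x_f hu (by norm_num)) (by norm_num)

theorem weight_lie_f (h : IsEmbeddable F e x f s sstar) {u : g}
    (hu : ⁅x, u⁆ = (1 / 2 : F) • u) : ⁅x, ⁅f, u⁆⁆ = (-(1 / 2) : F) • ⁅f, u⁆ :=
  lie_weight_add _ h.lie_x_f hu (by norm_num)

theorem weight_lie_s_lie_f (h : IsEmbeddable F e x f s sstar) {u : g}
    (hu : ⁅x, u⁆ = (1 / 2 : F) • u) : ⁅x, ⁅s, ⁅f, u⁆⁆⁆ = (0 : F) • ⁅s, ⁅f, u⁆⁆ :=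
  lie_weight_add _ h.lie_x_s (h.weight_lie_f hu) (by norm_num)

theorem weight_lie_s_lie_s_lie_f (h : IsEmbeddable F e x f s sstar) {u : g}
    (hu : ⁅x, u⁆ = (1 / 2 : F) • u) :
    ⁅x, ⁅s, ⁅s, ⁅f, u⁆⁆⁆⁆ = (1 / 2 : F) • ⁅s, ⁅s, ⁅f, u⁆⁆⁆ :=
  lie_weight_add _ h.lie_x_s (h.weight_lie_s_lie_f hu) (by norm_num)

theorem weight_lie_e_sstar (h : IsEmbeddable F e x f s sstar) :
    ⁅x, ⁅e, sstar⁆⁆ = (1 / 2 : F) • ⁅e, sstar⁆ :=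
  lie_weight_add _ h.lie_x_e h.lie_x_sstar (by norm_num)

theorem lie_e_s (h : IsEmbeddable F e x f s sstar) : ⁅e, s⁆ = 0 :=
  h.lie_e_of_weight_half h.lie_x_s

theorem lie_s_e (h : IsEmbeddable F e x f s sstar) : ⁅s, e⁆ = 0 := by
  rw [← lie_skew, h.lie_e_s, neg_zero]

theorem lie_f_sstar (h : IsEmbeddable F e x f s sstar) : ⁅f, sstar⁆ = 0 :=
  h.lie_f_of_weight_neg_half h.lie_x_sstar

theorem lie_e_lie_f (h : IsEmbeddable F e x f s sstar) {u : g}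
    (hu : ⁅x, u⁆ = (1 / 2 : F) • u) : ⁅e, ⁅f, u⁆⁆ = u := by
  rw [leibniz_lie, h.lie_e_f, smul_lie, hu, h.lie_e_of_weight_half hu, lie_zero]
  module

theorem lie_f_lie_e (h : IsEmbeddable F e x f s sstar) {u : g}
    (hu : ⁅x, u⁆ = (-(1 / 2) : F) • u) : ⁅f, ⁅e, u⁆⁆ = u := by
  rw [leibniz_lie, h.lie_f_e, smul_lie, hu, h.lie_f_of_weight_neg_half hu, lie_zero]
  module

theorem lie_s_lie_e_sstar (h : IsEmbeddable F e x f s sstar) :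
    ⁅s, ⁅e, sstar⁆⁆ = (-2 : F) • e := by
  rw [leibniz_lie, h.lie_s_e, h.lie_s_sstar, zero_lie, lie_smul, ← lie_skew e x, h.lie_x_e]
  module

theorem lie_e_sstar_lie_s (h : IsEmbeddable F e x f s sstar) :
    ⁅⁅e, sstar⁆, s⁆ = (2 : F) • e := by
  rw [← lie_skew, h.lie_s_lie_e_sstar]
  module

theorem lie_f_lie_s_lie_f (h : IsEmbeddable F e x f s sstar) {u : g}
    (hu : ⁅x, u⁆ = (1 / 2 : F) • u) (hsu : ⁅s, u⁆ = 0) : ⁅f, ⁅s, ⁅f, u⁆⁆⁆ = 0 := by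
  have hfu := h.lie_f_of_weight_neg_half (h.weight_lie_f hu)
  have hfs := h.lie_f_of_weight_neg_half (h.weight_lie_f h.lie_x_s)
  have h1 : ⁅f, ⁅s, ⁅f, u⁆⁆⁆ = ⁅⁅f, s⁆, ⁅f, u⁆⁆ := by
    rw [leibniz_lie, hfu, lie_zero, add_zero]
  have h2 : ⁅⁅f, s⁆, u⁆ + ⁅s, ⁅f, u⁆⁆ = 0 := by
    rw [← leibniz_lie, hsu, lie_zero]
  have h3 := congrArg (⁅f, ·⁆) h2
  simp only [lie_add, lie_zero] at h3
  rw [leibniz_lie f ⁅f, s⁆ u, hfs, zero_lie, zero_add, h1] at h3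
  rw [h1]
  linear_combination (norm := module) (1 / 2 : F) • h3

/-- The value of the quartic invariant of `g_{1/2}` at `s`, up to normalisation. It does not
vanish, by the representation theory of `sl₂` applied to the lowest weight vector `f`. -/
theorem exists_quartic (h : IsEmbeddable F e x f s sstar) :
    ∃ κ : F, κ ≠ 0 ∧ ⁅s, ⁅s, ⁅f, s⁆⁆⁆ = (-3 * κ) • ⁅e, sstar⁆ ∧
      ⁅s, ⁅f, s⁆⁆ = κ • ⁅⁅e, sstar⁆, sstar⁆ := by
  have w1 : ⁅x, ⁅s, f⁆⁆ = (-(1 / 2) : F) • ⁅s, f⁆ :=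
    lie_weight_add _ h.lie_x_s h.lie_x_f (by norm_num)
  have w2 : ⁅x, ⁅s, ⁅s, f⁆⁆⁆ = (0 : F) • ⁅s, ⁅s, f⁆⁆ :=
    lie_weight_add _ h.lie_x_s w1 (by norm_num)
  have w3 : ⁅x, ⁅s, ⁅s, ⁅s, f⁆⁆⁆⁆ = (1 / 2 : F) • ⁅s, ⁅s, ⁅s, f⁆⁆⁆ :=
    lie_weight_add _ h.lie_x_s w2 (by norm_num)
  have w4 : ⁅x, ⁅s, ⁅s, ⁅s, ⁅s, f⁆⁆⁆⁆⁆ = (1 : F) • ⁅s, ⁅s, ⁅s, ⁅s, f⁆⁆⁆⁆ :=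
    lie_weight_add _ h.lie_x_s w3 (by norm_num)
  have d1 : ⁅sstar, ⁅s, f⁆⁆ = (2 : F) • f := by
    rw [h.lie_sstar_lie_s, h.lie_x_f, ← lie_skew sstar f, h.lie_f_sstar, neg_zero, lie_zero]
    module
  have d2 : ⁅sstar, ⁅s, ⁅s, f⁆⁆⁆ = (3 : F) • ⁅s, f⁆ := by
    rw [h.lie_sstar_lie_s, w1, d1, lie_smul]
    module
  have d3 : ⁅sstar, ⁅s, ⁅s, ⁅s, f⁆⁆⁆⁆ = (3 : F) • ⁅s, ⁅s, f⁆⁆ := by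
    rw [h.lie_sstar_lie_s, w2, d2, lie_smul]
    module
  have d4 : ⁅sstar, ⁅s, ⁅s, ⁅s, ⁅s, f⁆⁆⁆⁆⁆ = (2 : F) • ⁅s, ⁅s, ⁅s, f⁆⁆⁆ := by
    rw [h.lie_sstar_lie_s, w3, d3, lie_smul]
    module
  obtain ⟨c, hc⟩ := h.exists_eq_smul_e w4
  have k3 : ⁅s, ⁅s, ⁅s, f⁆⁆⁆ = (-(c / 2)) • ⁅e, sstar⁆ := by
    rw [hc, lie_smul, ← lie_skew sstar e] at d4
    linear_combination (norm := module) (-(1 / 2) : F) • d4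
  have k2 : ⁅s, ⁅s, f⁆⁆ = (c / 6) • ⁅⁅e, sstar⁆, sstar⁆ := by
    rw [k3, lie_smul, ← lie_skew sstar] at d3
    linear_combination (norm := module) (-(1 / 3) : F) • d3
  have r2 : ⁅s, ⁅f, s⁆⁆ = -⁅s, ⁅s, f⁆⁆ := by rw [← lie_skew f s, lie_neg]
  by_cases hc0 : c = 0
  · have k1 : ⁅s, f⁆ = 0 := by
      rw [k2, hc0, zero_div, zero_smul, lie_zero] at d2
      linear_combination (norm := module) (-(1 / 3) : F) • d2
    have hf : f = 0 := by
      rw [k1, lie_zero] at d1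
      linear_combination (norm := module) (-(1 / 2) : F) • d1
    have hx : x = 0 := by
      have := h.lie_e_f
      rw [hf, lie_zero] at this
      linear_combination (norm := module) (-(1 / 2) : F) • this
    have he : e = 0 := by
      have := h.lie_x_e
      rwa [hx, zero_lie, one_smul, eq_comm] at this
    exact ⟨1, one_ne_zero, by simp [he, hf], by simp [he, hf]⟩
  · refine ⟨-c / 6, by simpa using hc0, ?_, ?_⟩
    · rw [r2, lie_neg, k3]
      module
    · rw [r2, k2]
      module

/-- The elements of `g_{1/2}` that commute with both `s` and `⁅e, sstar⁆`. -/
structure IsTransverse (F : Type*) {g : Type*} [Field F] [LieRing g] [LieAlgebra F g]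
    (e x s sstar u : g) : Prop where
  weight : ⁅x, u⁆ = (1 / 2 : F) • u
  lie_s : ⁅s, u⁆ = 0
  lie_t : ⁅⁅e, sstar⁆, u⁆ = 0

section Transverse

variable {u : g}

theorem lie_t_lie_f (h : IsEmbeddable F e x f s sstar) (hu : IsTransverse F e x s sstar u) :
    ⁅⁅e, sstar⁆, ⁅f, u⁆⁆ = -⁅sstar, u⁆ := by
  have := congrArg (⁅f, ·⁆) hu.lie_t
  simp only [lie_zero] at this
  rw [leibniz_lie, h.lie_f_lie_e h.lie_x_sstar] at this
  exact eq_neg_of_add_eq_zero_right this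

theorem lie_t_lie_s_lie_f (h : IsEmbeddable F e x f s sstar)
    (hu : IsTransverse F e x s sstar u) : ⁅⁅e, sstar⁆, ⁅s, ⁅f, u⁆⁆⁆ = u := by
  rw [leibniz_lie, h.lie_e_sstar_lie_s, smul_lie, h.lie_e_lie_f hu.weight, h.lie_t_lie_f hu,
    lie_neg, leibniz_lie s, h.lie_s_sstar, hu.lie_s, lie_zero, smul_lie, hu.weight]
  module

theorem lie_lie_f_s (hsu : ⁅s, u⁆ = 0) : ⁅⁅f, s⁆, u⁆ = -⁅s, ⁅f, u⁆⁆ := by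
  have := congrArg (⁅f, ·⁆) hsu
  simp only [lie_zero] at this
  rw [leibniz_lie] at this
  exact eq_neg_of_add_eq_zero_left this

theorem lie_s_lie_s_lie_f (hsu : ⁅s, u⁆ = 0) : ⁅s, ⁅s, ⁅f, u⁆⁆⁆ = -⁅⁅s, ⁅f, s⁆⁆, u⁆ := by
  rw [← neg_neg ⁅s, ⁅f, u⁆⁆, ← lie_lie_f_s hsu, lie_neg, leibniz_lie, hsu, lie_zero, add_zero]

theorem lie_t_lie_f_s (h : IsEmbeddable F e x f s sstar) :
    ⁅⁅e, sstar⁆, ⁅f, s⁆⁆ = (-2 : F) • x := by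
  have := congrArg (⁅f, ·⁆) h.lie_e_sstar_lie_s
  simp only [lie_smul, h.lie_f_e] at this
  rw [leibniz_lie, h.lie_f_lie_e h.lie_x_sstar, ← lie_skew, h.lie_s_sstar] at this
  linear_combination (norm := module) this

theorem transverse_lie_s_lie_s_lie_f (h : IsEmbeddable F e x f s sstar) {κ : F}
    (hκ : ⁅s, ⁅s, ⁅f, s⁆⁆⁆ = (-3 * κ) • ⁅e, sstar⁆) (hu : IsTransverse F e x s sstar u) :
    IsTransverse F e x s sstar ⁅s, ⁅s, ⁅f, u⁆⁆⁆ where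
  weight := h.weight_lie_s_lie_s_lie_f hu.weight
  lie_s := by
    rw [lie_s_lie_s_lie_f hu.lie_s, lie_neg, leibniz_lie, hκ, smul_lie, hu.lie_t, hu.lie_s,
      lie_zero, smul_zero, add_zero, neg_zero]
  lie_t := by
    rw [leibniz_lie, h.lie_t_lie_s_lie_f hu, h.lie_e_sstar_lie_s, hu.lie_s, smul_lie,
      leibniz_lie e, h.lie_e_s, h.lie_e_lie_f hu.weight, hu.lie_s, zero_lie, add_zero, add_zero,
      smul_zero]

theorem lie_s_lie_s_lie_f_twice (h : IsEmbeddable F e x f s sstar) {κ : F}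
    (hκ : ⁅s, ⁅s, ⁅f, s⁆⁆⁆ = (-3 * κ) • ⁅e, sstar⁆)
    (hκ' : ⁅s, ⁅f, s⁆⁆ = κ • ⁅⁅e, sstar⁆, sstar⁆) (hu : IsTransverse F e x s sstar u) :
    ⁅s, ⁅s, ⁅f, ⁅s, ⁅s, ⁅f, u⁆⁆⁆⁆⁆⁆ = (-κ) • u := by
  have hv := h.transverse_lie_s_lie_s_lie_f hκ hu
  have h1 : ⁅f, ⁅s, ⁅s, ⁅f, u⁆⁆⁆⁆ = ⁅⁅f, s⁆, ⁅s, ⁅f, u⁆⁆⁆ := by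
    rw [leibniz_lie, h.lie_f_lie_s_lie_f hu.weight hu.lie_s, lie_zero, add_zero]
  have h2 : ⁅⁅e, sstar⁆, ⁅f, ⁅s, ⁅s, ⁅f, u⁆⁆⁆⁆⁆ = -⁅s, ⁅f, u⁆⁆ := by
    rw [h1, leibniz_lie, h.lie_t_lie_f_s, h.lie_t_lie_s_lie_f hu, smul_lie,
      h.weight_lie_s_lie_f hu.weight, zero_smul, smul_zero, zero_add, lie_lie_f_s hu.lie_s]
  rw [lie_s_lie_s_lie_f hv.lie_s, hκ', smul_lie, lie_lie, hv.lie_t, lie_zero, sub_zero,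
    ← neg_neg ⁅sstar, _⁆, ← h.lie_t_lie_f hv, h2, neg_neg, h.lie_t_lie_s_lie_f hu, neg_smul]

theorem exists_transverse_of_weight_half (h : IsEmbeddable F e x f s sstar) {v : g}
    (hv : ⁅x, v⁆ = (1 / 2 : F) • v) :
    ∃ (a b : F) (w : g), IsTransverse F e x s sstar w ∧ v = a • s + b • ⁅e, sstar⁆ + w := by
  obtain ⟨a, ha⟩ := h.exists_eq_smul_e (lie_weight_add (1 : F) h.lie_x_s hv (by norm_num))
  obtain ⟨b, hb⟩ := h.exists_eq_smul_e
    (lie_weight_add (1 : F) h.weight_lie_e_sstar hv (by norm_num))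
  refine ⟨b / 2, -(a / 2), v - (b / 2) • s + (a / 2) • ⁅e, sstar⁆, ⟨?_, ?_, ?_⟩, by module⟩
  · simp only [lie_add, lie_sub, lie_smul, hv, h.lie_x_s, h.weight_lie_e_sstar]
    module
  · simp only [lie_add, lie_sub, lie_smul, ha, lie_self, h.lie_s_lie_e_sstar]
    module
  · simp only [lie_add, lie_sub, lie_smul, hb, lie_self, h.lie_e_sstar_lie_s]
    module

theorem exists_transverse_of_weight_zero (h : IsEmbeddable F e x f s sstar) {κ : F} (hκ0 : κ ≠ 0)
    (hκ : ⁅s, ⁅s, ⁅f, s⁆⁆⁆ = (-3 * κ) • ⁅e, sstar⁆)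
    (hκ' : ⁅s, ⁅f, s⁆⁆ = κ • ⁅⁅e, sstar⁆, sstar⁆) {a : g} (ha : ⁅x, a⁆ = 0) :
    ∃ (b c : F) (w a₀ : g), IsTransverse F e x s sstar w ∧ ⁅x, a₀⁆ = 0 ∧ ⁅s, a₀⁆ = 0 ∧
      a = b • x + c • ⁅s, ⁅f, s⁆⁆ + (-κ⁻¹) • ⁅s, ⁅f, w⁆⁆ + a₀ := by
  obtain ⟨p, q, w, hw, hsa⟩ := h.exists_transverse_of_weight_half
    (lie_weight_add (1 / 2 : F) h.lie_x_s (ha.trans (zero_smul F a).symm) (by norm_num))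
  have hv := h.transverse_lie_s_lie_s_lie_f hκ hw
  refine ⟨-2 * p, -(q / (3 * κ)), _, a + (2 * p) • x + (q / (3 * κ)) • ⁅s, ⁅f, s⁆⁆ +
    κ⁻¹ • ⁅s, ⁅f, ⁅s, ⁅s, ⁅f, w⁆⁆⁆⁆⁆, hv, ?_, ?_, by module⟩
  · simp only [lie_add, lie_smul, ha, lie_self, h.weight_lie_s_lie_f h.lie_x_s,
      h.weight_lie_s_lie_f hv.weight, zero_smul, smul_zero, add_zero]
  · simp only [lie_add, lie_smul, hsa, ← lie_skew s x, h.lie_x_s, hκ,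
      h.lie_s_lie_s_lie_f_twice hκ hκ' hw]
    match_scalars <;> field_simp <;> ring

end Transverse

/-- The centralizer of `s` in `g₀` also centralizes `f`. -/
theorem lie_f_of_weight_zero (h : IsEmbeddable F e x f s sstar) {a : g} (hxa : ⁅x, a⁆ = 0)
    (hsa : ⁅s, a⁆ = 0) : ⁅f, a⁆ = 0 := by
  have hax : ⁅a, x⁆ = 0 := by rw [← lie_skew, hxa, neg_zero]
  have has (y : g) : ⁅a, ⁅s, y⁆⁆ = ⁅s, ⁅a, y⁆⁆ := by
    rw [leibniz_lie, ← lie_skew a s, hsa, neg_zero, zero_lie, zero_add]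
  obtain ⟨c, hc⟩ := h.exists_eq_smul_f (y := ⁅a, f⁆)
    (lie_weight_add _ (hxa.trans (zero_smul F a).symm) h.lie_x_f (zero_add _))
  obtain ⟨κ, hκ0, hκ, -⟩ := h.exists_quartic
  have hat : ⁅a, ⁅e, sstar⁆⁆ = c • ⁅e, sstar⁆ := by
    have : ⁅a, ⁅s, ⁅s, ⁅f, s⁆⁆⁆⁆ = c • ⁅s, ⁅s, ⁅f, s⁆⁆⁆ := by
      rw [has, has, leibniz_lie a f, hc, ← lie_skew a s, hsa, neg_zero, lie_zero, add_zero,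
        smul_lie, lie_smul, lie_smul]
    rw [hκ, lie_smul] at this
    have hne : (-3 * κ) ≠ 0 := by simpa using hκ0
    apply smul_right_injective g hne
    linear_combination (norm := module) this
  have hae : ⁅a, e⁆ = c • e := by
    have : ⁅a, ⁅s, ⁅e, sstar⁆⁆⁆ = c • ⁅s, ⁅e, sstar⁆⁆ := by rw [has, hat, lie_smul]
    rw [h.lie_s_lie_e_sstar, lie_smul] at this
    linear_combination (norm := module) (-(1 / 2) : F) • this
  have hcx : c • x = 0 := by
    have : ⁅a, ⁅e, f⁆⁆ = c • ⁅e, f⁆ + c • ⁅e, f⁆ := by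
      rw [leibniz_lie a e, hae, hc, smul_lie, lie_smul]
    rw [h.lie_e_f, lie_smul, hax, smul_zero] at this
    linear_combination (norm := module) (-(1 / 4) : F) • this
  have hcf : c • f = 0 := by
    have : ⁅c • x, f⁆ = 0 := by rw [hcx, zero_lie]
    rw [smul_lie, h.lie_x_f] at this
    linear_combination (norm := module) -this
  rw [← lie_skew, hc, hcf, neg_zero]

end Weights

end IsEmbeddable

end EmbeddableTriple

section Spectral

open Polynomial

variable {K M : Type*} [Field K] [AddCommGroup M] [Module K M]

theorem mem_ker_aeval_pow_sub (A : Module.End K M) (n : ℕ) (c : K) (y : M) :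
    y ∈ LinearMap.ker (aeval A (X ^ n - C c)) ↔ (A ^ n) y = c • y := by
  simp [sub_eq_zero]

theorem mem_ker_pow_six_sub_of_cycle (A : Module.End K M) {a₁ a₂ a₃ a₄ a₅ a₆ : M}
    {c₁ c₂ c₃ c₄ c₅ c₆ c : K} (h₁ : A a₁ = c₁ • a₂) (h₂ : A a₂ = c₂ • a₃) (h₃ : A a₃ = c₃ • a₄)
    (h₄ : A a₄ = c₄ • a₅) (h₅ : A a₅ = c₅ • a₆) (h₆ : A a₆ = c₆ • a₁)
    (hc : c₁ * c₂ * c₃ * c₄ * c₅ * c₆ = c) :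
    a₁ ∈ LinearMap.ker (aeval A (X ^ 6 - C c)) := by
  rw [mem_ker_aeval_pow_sub]
  simp only [pow_succ', pow_zero, mul_one, Module.End.mul_apply, h₁, h₂,
    h₃, h₄, h₅, h₆, map_smul, smul_smul, hc]

theorem mem_range_of_apply_eq_smul (A : Module.End K M) {c : K} (hc : c ≠ 0) {y w : M}
    (h : A y = c • w) : w ∈ LinearMap.range A :=
  ⟨c⁻¹ • y, by rw [map_smul, h, smul_smul, inv_mul_cancel₀ hc, one_smul]⟩

theorem ker_pow_sub_le_range (A : Module.End K M) {n : ℕ} (hn : n ≠ 0) {c : K} (hc : c ≠ 0) :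
    LinearMap.ker (aeval A (X ^ n - C c)) ≤ LinearMap.range A := by
  intro y hy
  obtain ⟨m, rfl⟩ := Nat.exists_eq_succ_of_ne_zero hn
  rw [mem_ker_aeval_pow_sub, Nat.succ_eq_add_one, pow_succ', Module.End.mul_apply] at hy
  exact ⟨c⁻¹ • (A ^ m) y, by rw [map_smul, hy, smul_smul, inv_mul_cancel₀ hc, one_smul]⟩

theorem ker_aeval_le_of_dvd (A : Module.End K M) {p q : K[X]} (hpq : p ∣ q) :
    LinearMap.ker (aeval A p) ≤ LinearMap.ker (aeval A q) := by
  obtain ⟨r, rfl⟩ := hpq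
  intro y hy
  rw [LinearMap.mem_ker] at hy ⊢
  rw [mul_comm, map_mul, Module.End.mul_apply, hy, map_zero]

/-- If `M` is spanned by a subspace `N` of `ker A` and the eigenspaces of `A ^ n` for two distinct
nonzero eigenvalues, then `A` is semisimple, with kernel `N` and `M = N ⊕ im A`. -/
theorem isSemisimple_of_sup_ker_pow_sub_eq_top [CharZero K] {A : Module.End K M} {n : ℕ}
    (hn : n ≠ 0) {N : Submodule K M} {α β : K} (hN : N ≤ LinearMap.ker A) (hα : α ≠ 0)
    (hβ : β ≠ 0) (hαβ : α ≠ β)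
    (htop : N ⊔ LinearMap.ker (aeval A (X ^ n - C α)) ⊔ LinearMap.ker (aeval A (X ^ n - C β)) = ⊤) :
    A.IsSemisimple ∧ LinearMap.ker A = N ∧ IsCompl N (LinearMap.range A) := by
  set q : K[X] := (X ^ n - C α) * (X ^ n - C β) with hq
  have hn' : (n : K) ≠ 0 := Nat.cast_ne_zero.mpr hn
  have hαβ' : IsCoprime (X ^ n - C α) (X ^ n - C β : K[X]) :=
    ⟨C (β - α)⁻¹, -C (β - α)⁻¹, by
      have : C (β - α)⁻¹ * (C β - C α) = (1 : K[X]) := by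
        rw [← C_sub, ← C_mul, inv_mul_cancel₀ (sub_ne_zero.mpr hαβ.symm), C_1]
      linear_combination this⟩
  have hX (c : K) (hc : c ≠ 0) : IsCoprime X (X ^ n - C c : K[X]) := by
    obtain ⟨m, rfl⟩ := Nat.exists_eq_succ_of_ne_zero hn
    have : C c⁻¹ * C c = (1 : K[X]) := by rw [← C_mul, inv_mul_cancel₀ hc, C_1]
    exact ⟨C c⁻¹ * X ^ m, -C c⁻¹, by
      rw [Nat.succ_eq_add_one, pow_succ]
      linear_combination this⟩
  have hsq : Squarefree (X * q) :=
    (separable_X.mul ((separable_X_pow_sub_C α hn' hα).mul (separable_X_pow_sub_C β hn' hβ) hαβ')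
      ((hX α hα).mul_right (hX β hβ))).squarefree
  have hzero : aeval A (X * q) = 0 := by
    rw [← LinearMap.ker_eq_top, eq_top_iff, ← htop]
    refine sup_le (sup_le (hN.trans ?_) ?_) ?_
    · conv_lhs => rw [← aeval_X (R := K) A]
      exact ker_aeval_le_of_dvd A (dvd_mul_right _ _)
    · exact ker_aeval_le_of_dvd A ((dvd_mul_right _ _).mul_left _)
    · exact ker_aeval_le_of_dvd A ((dvd_mul_left _ _).mul_left _)
  have hdisj : Disjoint (LinearMap.ker A) (LinearMap.range A) := by
    rw [Submodule.disjoint_def]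
    rintro _ hy ⟨w, rfl⟩
    rw [LinearMap.mem_ker] at hy
    have hpow : (A ^ n) (A w) = 0 := by
      obtain ⟨m, rfl⟩ := Nat.exists_eq_succ_of_ne_zero hn
      rw [Nat.succ_eq_add_one, pow_succ, Module.End.mul_apply, hy, map_zero]
    have h1 : aeval A q (A w) = (α * β) • A w := by
      simp only [hq, map_mul, map_sub, map_pow, aeval_X, aeval_C, LinearMap.sub_apply,
        Module.End.mul_apply, Module.algebraMap_end_apply, hpow, map_smul, zero_sub, map_neg, smul_neg, neg_neg, smul_smul, mul_comm β]
    have h2 : aeval A q (A w) = 0 := by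
      have := LinearMap.congr_fun hzero w
      rwa [mul_comm, map_mul, aeval_X, Module.End.mul_apply, LinearMap.zero_apply] at this
    exact (smul_eq_zero.mp (h1.symm.trans h2)).resolve_left (mul_ne_zero hα hβ)
  have hcompl : IsCompl N (LinearMap.range A) := by
    refine ⟨hdisj.mono_left hN, codisjoint_iff.mpr (eq_top_iff.mpr ?_)⟩
    rw [← htop]
    exact sup_le (sup_le_sup_left (ker_pow_sub_le_range A hn hα) N)
      ((ker_pow_sub_le_range A hn hβ).trans le_sup_right)
  refine ⟨Module.End.isSemisimple_of_squarefree_aeval_eq_zero hsq hzero, ?_, hcompl⟩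
  exact (eq_of_le_of_inf_le_of_sup_le hN (hdisj.eq_bot.trans_le bot_le)
    (le_top.trans hcompl.sup_eq_top.ge)).symm

end Spectral

section BaseChange

open Polynomial

variable {F K g : Type*} [Field F] [Field K] [Algebra F K] [LieRing g] [LieAlgebra F g]

/-- The operator `ad (f + zs)` on `K ⊗ g`. -/
noncomputable abbrev adPencil (z : K) (f s : g) : Module.End K (K ⊗[F] g) :=
  LieAlgebra.ad K (K ⊗[F] g) ((1 : K) ⊗ₜ[F] f + z ⊗ₜ[F] s)

theorem tmul_eq_smul_one_tmul' (k : K) (y : g) : k ⊗ₜ[F] y = k • ((1 : K) ⊗ₜ[F] y) := by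
  rw [TensorProduct.smul_tmul', smul_eq_mul, mul_one]

theorem one_tmul_smul (c : F) (y : g) :
    (1 : K) ⊗ₜ[F] (c • y) = algebraMap F K c • ((1 : K) ⊗ₜ[F] y) := by
  rw [TensorProduct.tmul_smul, algebraMap_smul]

theorem adPencil_one_tmul (z : K) (f s y : g) :
    adPencil (F := F) z f s ((1 : K) ⊗ₜ[F] y)
      = (1 : K) ⊗ₜ[F] ⁅f, y⁆ + z • ((1 : K) ⊗ₜ[F] ⁅s, y⁆) := by
  simp [LieAlgebra.ExtendScalars.bracket_tmul, TensorProduct.smul_tmul']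

/-- `g₀^s ⊕ F(f + zs) ⊕ F(e + z⁻¹ sstar)` after extension of scalars. -/
noncomputable def pencilCentralizer (F : Type*) {K g : Type*} [Field F] [Field K] [Algebra F K]
    [LieRing g] [LieAlgebra F g] (z : K) (e x f s sstar : g) : Submodule K (K ⊗[F] g) :=
  Submodule.span K
    ({(1 : K) ⊗ₜ[F] f + z ⊗ₜ[F] s}
      ∪ {w | ∃ a : g, ⁅x, a⁆ = 0 ∧ ⁅s, a⁆ = 0 ∧ w = (1 : K) ⊗ₜ[F] a}
      ∪ {(1 : K) ⊗ₜ[F] e + z⁻¹ ⊗ₜ[F] sstar})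

namespace IsEmbeddable

variable {e x f s sstar : g}

theorem adPencil_e_add_sstar [CharZero F] (h : IsEmbeddable F e x f s sstar) {z : K}
    (hz : z ≠ 0) :
    adPencil (F := F) z f s ((1 : K) ⊗ₜ[F] e + z⁻¹ ⊗ₜ[F] sstar) = 0 := by
  rw [tmul_eq_smul_one_tmul' z⁻¹, map_add, map_smul, adPencil_one_tmul, adPencil_one_tmul,
    h.lie_f_e, h.lie_s_e, h.lie_f_sstar, h.lie_s_sstar, TensorProduct.tmul_zero, one_tmul_smul,
    one_tmul_smul, map_neg, map_ofNat]
  match_scalars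
  field_simp
  ring

theorem adPencil_x [CharZero K] (h : IsEmbeddable F e x f s sstar) (z : K) :
    adPencil (F := F) z f s ((1 : K) ⊗ₜ[F] x)
      = (1 / 2 : K) • ((2 : K) • ((1 : K) ⊗ₜ[F] f) - z ⊗ₜ[F] s) := by
  rw [tmul_eq_smul_one_tmul' z, adPencil_one_tmul, ← lie_skew f x, ← lie_skew s x, h.lie_x_f,
    h.lie_x_s, ← neg_smul, ← neg_smul, one_tmul_smul, one_tmul_smul]
  simp only [map_neg, map_one, map_div₀, map_ofNat]
  module

theorem adPencil_two_smul_x [CharZero K] (h : IsEmbeddable F e x f s sstar) (z : K) :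
    adPencil (F := F) z f s ((2 : K) • ((1 : K) ⊗ₜ[F] x))
      = (2 : K) • ((1 : K) ⊗ₜ[F] f) - z ⊗ₜ[F] s := by
  rw [map_smul, h.adPencil_x, smul_smul, mul_one_div_cancel two_ne_zero, one_smul]

theorem adPencil_two_f_sub (z : K) :
    adPencil (F := F) z f s ((2 : K) • ((1 : K) ⊗ₜ[F] f) - z ⊗ₜ[F] s)
      = (-3 * z) • ((1 : K) ⊗ₜ[F] ⁅f, s⁆) := by
  rw [tmul_eq_smul_one_tmul' z, map_sub, map_smul, map_smul, adPencil_one_tmul,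
    adPencil_one_tmul, lie_self, lie_self, ← lie_skew s f, TensorProduct.tmul_neg,
    TensorProduct.tmul_zero]
  module

theorem adPencil_lie_f [CharZero F] (h : IsEmbeddable F e x f s sstar) (z : K) {u : g}
    (hu : ⁅x, u⁆ = (1 / 2 : F) • u) :
    adPencil (F := F) z f s ((1 : K) ⊗ₜ[F] ⁅f, u⁆) = z • ((1 : K) ⊗ₜ[F] ⁅s, ⁅f, u⁆⁆) := by
  rw [adPencil_one_tmul, h.lie_f_of_weight_neg_half (h.weight_lie_f hu),
    TensorProduct.tmul_zero, zero_add]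

theorem adPencil_lie_s_lie_f [CharZero F] (h : IsEmbeddable F e x f s sstar) (z : K) {u : g}
    (hu : ⁅x, u⁆ = (1 / 2 : F) • u) (hsu : ⁅s, u⁆ = 0) :
    adPencil (F := F) z f s ((1 : K) ⊗ₜ[F] ⁅s, ⁅f, u⁆⁆)
      = z • ((1 : K) ⊗ₜ[F] ⁅s, ⁅s, ⁅f, u⁆⁆⁆) := by
  rw [adPencil_one_tmul, h.lie_f_lie_s_lie_f hu hsu, TensorProduct.tmul_zero, zero_add]

theorem adPencil_of_lie_s (z : K) {u : g} (hsu : ⁅s, u⁆ = 0) :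
    adPencil (F := F) z f s ((1 : K) ⊗ₜ[F] u) = (1 : K) • ((1 : K) ⊗ₜ[F] ⁅f, u⁆) := by
  rw [adPencil_one_tmul, hsu, TensorProduct.tmul_zero, smul_zero, add_zero, one_smul]

theorem adPencil_lie_e_sstar [CharZero F] (h : IsEmbeddable F e x f s sstar) {z : K}
    (hz : z ≠ 0) :
    adPencil (F := F) z f s ((1 : K) ⊗ₜ[F] ⁅e, sstar⁆)
      = (-z) • ((2 : K) • ((1 : K) ⊗ₜ[F] e) - z⁻¹ ⊗ₜ[F] sstar) := by
  rw [tmul_eq_smul_one_tmul' z⁻¹, adPencil_one_tmul, h.lie_f_lie_e h.lie_x_sstar,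
    h.lie_s_lie_e_sstar, one_tmul_smul, map_neg, map_ofNat]
  match_scalars <;> field_simp

theorem adPencil_two_e_sub [CharZero F] (h : IsEmbeddable F e x f s sstar) {z : K}
    (hz : z ≠ 0) :
    adPencil (F := F) z f s ((2 : K) • ((1 : K) ⊗ₜ[F] e) - z⁻¹ ⊗ₜ[F] sstar)
      = (-6 : K) • ((1 : K) ⊗ₜ[F] x) := by
  rw [tmul_eq_smul_one_tmul' z⁻¹, map_sub, map_smul, map_smul, adPencil_one_tmul,
    adPencil_one_tmul, h.lie_f_e, h.lie_s_e, h.lie_f_sstar, h.lie_s_sstar,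
    TensorProduct.tmul_zero, one_tmul_smul, one_tmul_smul, map_neg, map_ofNat]
  match_scalars
  field_simp
  ring

theorem pencilCentralizer_le_ker [CharZero F] (h : IsEmbeddable F e x f s sstar) {z : K}
    (hz : z ≠ 0) :
    pencilCentralizer F z e x f s sstar ≤ LinearMap.ker (adPencil (F := F) z f s) := by
  refine Submodule.span_le.mpr ?_
  rintro _ ((rfl | ⟨a, hxa, hsa, rfl⟩) | rfl)
  · simp only [SetLike.mem_coe, LinearMap.mem_ker, LieAlgebra.ad_apply, lie_self]
  · rw [SetLike.mem_coe, LinearMap.mem_ker, adPencil_of_lie_s z hsa, h.lie_f_of_weight_zero hxa hsa,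
      TensorProduct.tmul_zero, smul_zero]
  · exact h.adPencil_e_add_sstar hz

theorem pencil_isSemisimple [CharZero K] (h : IsEmbeddable F e x f s sstar) {z : K}
    (hz : z ≠ 0) :
    (adPencil (F := F) z f s).IsSemisimple ∧
      LinearMap.ker (adPencil (F := F) z f s) = pencilCentralizer F z e x f s sstar ∧
      (1 : K) ⊗ₜ[F] x ∈ LinearMap.range (adPencil (F := F) z f s) ∧
      (2 : K) • ((1 : K) ⊗ₜ[F] e) - z⁻¹ ⊗ₜ[F] sstar
        ∈ LinearMap.range (adPencil (F := F) z f s) ∧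
      IsCompl (pencilCentralizer F z e x f s sstar)
        (LinearMap.range (adPencil (F := F) z f s)) := by
  have : CharZero F := (algebraMap F K).charZero_iff (algebraMap F K).injective |>.mpr inferInstance
  obtain ⟨κ, hκ0, hκ, hκ'⟩ := h.exists_quartic
  set A := adPencil (F := F) z f s with hA
  set k : K := algebraMap F K κ with hk
  have hk0 : k ≠ 0 := by simpa [hk] using hκ0
  set α : K := 27 * k * z ^ 4 with hα
  set β : K := -k * z ^ 4 with hβ
  have hα0 : α ≠ 0 := by simp [hα, hk0, hz]
  have hβ0 : β ≠ 0 := by simp [hβ, hk0, hz]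
  have hαβ : α ≠ β := fun hαβ => by
    have : 28 * (k * z ^ 4) = 0 := by linear_combination hαβ
    simp [hk0, hz] at this
  have a₁ := h.adPencil_x z
  have a₂ := adPencil_two_f_sub (F := F) (f := f) (s := s) z
  have a₃ := h.adPencil_lie_f z h.lie_x_s
  have a₄ : A ((1 : K) ⊗ₜ[F] ⁅s, ⁅f, s⁆⁆) = (z * (-3 * k)) • ((1 : K) ⊗ₜ[F] ⁅e, sstar⁆) := by
    rw [hA, h.adPencil_lie_s_lie_f z h.lie_x_s (lie_self s), hκ, one_tmul_smul, smul_smul,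
      map_mul, map_neg, map_ofNat]
  have a₅ := h.adPencil_lie_e_sstar hz
  have a₆ := h.adPencil_two_e_sub hz
  have m₁ := mem_ker_pow_six_sub_of_cycle A a₁ a₂ a₃ a₄ a₅ a₆ (c := α) (by rw [hα]; ring)
  have m₂ := mem_ker_pow_six_sub_of_cycle A a₂ a₃ a₄ a₅ a₆ a₁ (c := α) (by rw [hα]; ring)
  have m₃ := mem_ker_pow_six_sub_of_cycle A a₃ a₄ a₅ a₆ a₁ a₂ (c := α) (by rw [hα]; ring)
  have m₄ := mem_ker_pow_six_sub_of_cycle A a₄ a₅ a₆ a₁ a₂ a₃ (c := α) (by rw [hα]; ring)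
  have m₅ := mem_ker_pow_six_sub_of_cycle A a₅ a₆ a₁ a₂ a₃ a₄ (c := α) (by rw [hα]; ring)
  have m₆ := mem_ker_pow_six_sub_of_cycle A a₆ a₁ a₂ a₃ a₄ a₅ (c := α) (by rw [hα]; ring)
  have mW (w : g) (hw : IsTransverse F e x s sstar w) :
      (1 : K) ⊗ₜ[F] w ∈ LinearMap.ker (aeval A (X ^ 6 - C β)) ∧
      (1 : K) ⊗ₜ[F] ⁅f, w⁆ ∈ LinearMap.ker (aeval A (X ^ 6 - C β)) ∧
      (1 : K) ⊗ₜ[F] ⁅s, ⁅f, w⁆⁆ ∈ LinearMap.ker (aeval A (X ^ 6 - C β)) := by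
    have hv := h.transverse_lie_s_lie_s_lie_f hκ hw
    have b₁ := adPencil_of_lie_s (F := F) (f := f) z hw.lie_s
    have b₂ := h.adPencil_lie_f z hw.weight
    have b₃ := h.adPencil_lie_s_lie_f z hw.weight hw.lie_s
    have b₄ := adPencil_of_lie_s (F := F) (f := f) z hv.lie_s
    have b₅ := h.adPencil_lie_f z hv.weight
    have b₆ := h.adPencil_lie_s_lie_f z hv.weight hv.lie_s
    rw [h.lie_s_lie_s_lie_f_twice hκ hκ' hw, one_tmul_smul, smul_smul, map_neg] at b₆
    exact ⟨mem_ker_pow_six_sub_of_cycle A b₁ b₂ b₃ b₄ b₅ b₆ (by rw [hβ]; ring),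
      mem_ker_pow_six_sub_of_cycle A b₂ b₃ b₄ b₅ b₆ b₁ (by rw [hβ]; ring),
      mem_ker_pow_six_sub_of_cycle A b₃ b₄ b₅ b₆ b₁ b₂ (by rw [hβ]; ring)⟩
  set N := pencilCentralizer F z e x f s sstar
  set P := N ⊔ LinearMap.ker (aeval A (X ^ 6 - C α)) ⊔ LinearMap.ker (aeval A (X ^ 6 - C β))
  have hNP : N ≤ P := le_sup_left.trans le_sup_left
  have hαP : LinearMap.ker (aeval A (X ^ 6 - C α)) ≤ P := le_sup_right.trans le_sup_left
  have hβP : LinearMap.ker (aeval A (X ^ 6 - C β)) ≤ P := le_sup_right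
  have hmem (w : K ⊗[F] g) (hw : w ∈ ({(1 : K) ⊗ₜ[F] f + z ⊗ₜ[F] s}
      ∪ {w | ∃ a : g, ⁅x, a⁆ = 0 ∧ ⁅s, a⁆ = 0 ∧ w = (1 : K) ⊗ₜ[F] a}
      ∪ {(1 : K) ⊗ₜ[F] e + z⁻¹ ⊗ₜ[F] sstar} : Set (K ⊗[F] g))) : w ∈ P :=
    hNP (Submodule.subset_span hw)
  have pΛ := hmem _ (Or.inl (Or.inl rfl))
  have pE := hmem _ (Or.inr rfl)
  have pA (a : g) (hxa : ⁅x, a⁆ = 0) (hsa : ⁅s, a⁆ = 0) : (1 : K) ⊗ₜ[F] a ∈ P :=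
    hmem _ (Or.inl (Or.inr ⟨a, hxa, hsa, rfl⟩))
  let Q : Submodule F g := (P.restrictScalars F).comap (TensorProduct.mk F K g 1)
  have pf : (1 : K) ⊗ₜ[F] f ∈ P := by
    convert P.smul_mem (1 / 3 : K) (P.add_mem pΛ (hαP m₂)) using 1
    module
  have pe : (1 : K) ⊗ₜ[F] e ∈ P := by
    convert P.smul_mem (1 / 3 : K) (P.add_mem pE (hαP m₆)) using 1
    module
  have qf : f ∈ Q := pf
  have qe : e ∈ Q := pe
  have qs : s ∈ Q := by
    have := P.smul_mem z⁻¹ (P.sub_mem pΛ pf)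
    rwa [add_sub_cancel_left, TensorProduct.smul_tmul', smul_eq_mul, inv_mul_cancel₀ hz] at this
  have qsstar : sstar ∈ Q := by
    have := P.smul_mem z (P.sub_mem pE pe)
    rwa [add_sub_cancel_left, TensorProduct.smul_tmul', smul_eq_mul, mul_inv_cancel₀ hz] at this
  have qx : x ∈ Q := hαP m₁
  have qfs : ⁅f, s⁆ ∈ Q := hαP m₃
  have qsfs : ⁅s, ⁅f, s⁆⁆ ∈ Q := hαP m₄
  have qt : ⁅e, sstar⁆ ∈ Q := hαP m₅
  have htop : P = ⊤ := by
    suffices hQ : ∀ y, y ∈ Q by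
      refine eq_top_iff.mpr fun y _ => ?_
      induction y using TensorProduct.induction_on with
      | zero => exact P.zero_mem
      | tmul c y =>
        rw [tmul_eq_smul_one_tmul']
        exact P.smul_mem c (hQ y)
      | add y y' hy hy' => exact P.add_mem (hy trivial) (hy' trivial)
    intro y
    obtain ⟨c₁, c₂, u, a, v, hu, ha, hv, rfl⟩ := h.grading y
    have qv : v ∈ Q := by
      obtain ⟨p, q, w, hw, rfl⟩ := h.exists_transverse_of_weight_half hv
      exact Q.add_mem (Q.add_mem (Q.smul_mem p qs) (Q.smul_mem q qt)) (hβP (mW w hw).1)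
    have qu : u ∈ Q := by
      obtain ⟨p, q, w, hw, heu⟩ := h.exists_transverse_of_weight_half
        (lie_weight_add (1 / 2 : F) h.lie_x_e hu (by norm_num))
      rw [← h.lie_f_lie_e hu, heu, lie_add, lie_add, lie_smul, lie_smul,
        h.lie_f_lie_e h.lie_x_sstar]
      exact Q.add_mem (Q.add_mem (Q.smul_mem p qfs) (Q.smul_mem q qsstar)) (hβP (mW w hw).2.1)
    have qa : a ∈ Q := by
      obtain ⟨p, q, w, a₀, hw, hxa, hsa, rfl⟩ := h.exists_transverse_of_weight_zero hκ0 hκ hκ' ha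
      exact Q.add_mem (Q.add_mem (Q.add_mem (Q.smul_mem p qx) (Q.smul_mem q qsfs))
        (Q.smul_mem _ (hβP (mW w hw).2.2))) (pA a₀ hxa hsa)
    exact Q.add_mem (Q.add_mem (Q.add_mem (Q.add_mem (Q.smul_mem c₁ qf) qu) qa) qv)
      (Q.smul_mem c₂ qe)
  obtain ⟨hss, hker, hcompl⟩ := isSemisimple_of_sup_ker_pow_sub_eq_top (by norm_num)
    (h.pencilCentralizer_le_ker hz) hα0 hβ0 hαβ htop
  have hrange := ker_pow_sub_le_range A (n := 6) (by norm_num) hα0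
  exact ⟨hss, hker, hrange m₁, hrange m₆, hcompl⟩

end IsEmbeddable

end BaseChange

/-- For a minimal nilpotent f and an embeddable s ∈ g_{1/2} with [s,s*] = 2x,
the element f + zs is ad-semisimple in g((z⁻¹)), with
Ker ad(f+zs) = F(f+zs)((z⁻¹)) ⊕ g₀^s((z⁻¹)) ⊕ F(e+z⁻¹s*)((z⁻¹)), and
Im ad(f+zs) contains 2f-zs, x, 2e-z⁻¹s*, [f,g_{1/2}^s], [s,[f,g_{1/2}^s]] and
[s,[s,[f,g_{1/2}^s]]]; moreover g((z⁻¹)) = Ker ⊕ Im; in particular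
[f+zs, e+z⁻¹s*] = 0 and [f+zs, 2x] = 2f - zs. -/
theorem stmt12 {F : Type*} [Field F] [CharZero F] [IsAlgClosed F]
    {g : Type*} [LieRing g] [LieAlgebra F g] [FiniteDimensional F g]
    [LieAlgebra.IsSimple F g]
    (e x f : g)
    (hef : ⁅e, f⁆ = (2 : F) • x) (hxe : ⁅x, e⁆ = e) (hxf : ⁅x, f⁆ = -f)
    (hmin : ∀ y : g, ∃ (c₁ c₂ : F) (u a v : g),
      ⁅x, u⁆ = (-(1 / 2 : F)) • u ∧ ⁅x, a⁆ = 0 ∧ ⁅x, v⁆ = (1 / 2 : F) • v ∧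
      y = c₁ • f + u + a + v + c₂ • e)
    (s sstar : g)
    (hs : ⁅x, s⁆ = (1 / 2 : F) • s) (hsstar : ⁅x, sstar⁆ = (-(1 / 2 : F)) • sstar)
    (hss : ⁅s, sstar⁆ = (2 : F) • x)
    (z : LaurentSeries F) (hz : z = HahnSeries.single (-1) 1)
    (Λ : LaurentSeries F ⊗[F] g)
    (hΛ : Λ = (1 : LaurentSeries F) ⊗ₜ[F] f + z ⊗ₜ[F] s)
    (Hk : Submodule (LaurentSeries F) (LaurentSeries F ⊗[F] g))
    (hHk : Hk = Submodule.span (LaurentSeries F)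
      ({Λ}
        ∪ {w | ∃ a : g, ⁅x, a⁆ = 0 ∧ ⁅s, a⁆ = 0 ∧ w = (1 : LaurentSeries F) ⊗ₜ[F] a}
        ∪ {(1 : LaurentSeries F) ⊗ₜ[F] e + z⁻¹ ⊗ₜ[F] sstar})) :
    ⁅Λ, (1 : LaurentSeries F) ⊗ₜ[F] e + z⁻¹ ⊗ₜ[F] sstar⁆ = 0 ∧
    ⁅Λ, (2 : LaurentSeries F) • ((1 : LaurentSeries F) ⊗ₜ[F] x)⁆
      = (2 : LaurentSeries F) • ((1 : LaurentSeries F) ⊗ₜ[F] f) - z ⊗ₜ[F] s ∧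
    (LieAlgebra.ad (LaurentSeries F) (LaurentSeries F ⊗[F] g) Λ).IsSemisimple ∧
    LinearMap.ker (LieAlgebra.ad (LaurentSeries F) (LaurentSeries F ⊗[F] g) Λ) = Hk ∧
    ((2 : LaurentSeries F) • ((1 : LaurentSeries F) ⊗ₜ[F] f) - z ⊗ₜ[F] s
        ∈ LinearMap.range (LieAlgebra.ad (LaurentSeries F) (LaurentSeries F ⊗[F] g) Λ)) ∧
    ((1 : LaurentSeries F) ⊗ₜ[F] x
        ∈ LinearMap.range (LieAlgebra.ad (LaurentSeries F) (LaurentSeries F ⊗[F] g) Λ)) ∧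
    ((2 : LaurentSeries F) • ((1 : LaurentSeries F) ⊗ₜ[F] e) - z⁻¹ ⊗ₜ[F] sstar
        ∈ LinearMap.range (LieAlgebra.ad (LaurentSeries F) (LaurentSeries F ⊗[F] g) Λ)) ∧
    (∀ u : g, ⁅x, u⁆ = (1 / 2 : F) • u → ⁅s, u⁆ = 0 →
      ((1 : LaurentSeries F) ⊗ₜ[F] ⁅f, u⁆
          ∈ LinearMap.range (LieAlgebra.ad (LaurentSeries F) (LaurentSeries F ⊗[F] g) Λ)) ∧
      ((1 : LaurentSeries F) ⊗ₜ[F] ⁅s, ⁅f, u⁆⁆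
          ∈ LinearMap.range (LieAlgebra.ad (LaurentSeries F) (LaurentSeries F ⊗[F] g) Λ)) ∧
      ((1 : LaurentSeries F) ⊗ₜ[F] ⁅s, ⁅s, ⁅f, u⁆⁆⁆
          ∈ LinearMap.range (LieAlgebra.ad (LaurentSeries F) (LaurentSeries F ⊗[F] g) Λ))) ∧
    IsCompl Hk
      (LinearMap.range (LieAlgebra.ad (LaurentSeries F) (LaurentSeries F ⊗[F] g) Λ)) := by
  have h : IsEmbeddable F e x f s sstar :=
    ⟨hef, by rw [hxe, one_smul], by rw [hxf, neg_one_smul], hmin, hs, hsstar, hss⟩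
  have hz0 : z ≠ 0 := by
    rw [hz]
    exact HahnSeries.single_ne_zero one_ne_zero
  have : CharZero (LaurentSeries F) :=
    charZero_of_injective_algebraMap (algebraMap F (LaurentSeries F)).injective
  subst hΛ hHk
  obtain ⟨hsemi, hker, hx, he, hcompl⟩ := h.pencil_isSemisimple hz0
  have h2x := h.adPencil_two_smul_x z
  refine ⟨h.adPencil_e_add_sstar hz0, h2x, hsemi, hker, ⟨_, h2x⟩, hx, he, ?_, hcompl⟩
  intro u hu hsu
  have lie_f := IsEmbeddable.adPencil_of_lie_s (F := F) (f := f) z hsu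
  have lie_s := h.adPencil_lie_f z hu
  have lie_s_s := h.adPencil_lie_s_lie_f z hu hsu
  rw [one_smul] at lie_f
  exact ⟨⟨_, lie_f⟩, mem_range_of_apply_eq_smul _ hz0 lie_s,
    mem_range_of_apply_eq_smul _ hz0 lie_s_s⟩
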